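/- There exist a finite group G of order 4 (the Klein four-group), a subgroup K of G of order 2, an element t ∈ G \ K, odd primes p₁ and p₂, and finite-dimensional modules V₁ over the algebraic closure of 𝔽_{p₁} and V₂ over the algebraic closure of 𝔽_{p₂}, each of dimension 3 and each completely reducible as a G-module, such that no element g of the coset Kt satisfies both dim(C_{V₁}(g)) ≤ (1/2)·dim(V₁) and dim(C_{V₂}(g)) ≤ (1/2)·dim(V₂). -/

import Mathlib

universe u

section RepDefs

variable {F : Type*} [Field F] {G : Type*} [Group G] {V : Type u}
  [AddCommGroup V] [Module F V]

/-- A subspace `U` is stable under the action (via `ρ`) of the subgroup `N` of `G`. -/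
def Stable (ρ : Representation F G V) (N : Subgroup G) (U : Submodule F V) : Prop :=
  ∀ n ∈ N, ∀ v ∈ U, ρ n v ∈ U

/-- `U` is an irreducible `N`-submodule: it is nonzero and has no proper nonzero
`N`-stable subspaces. -/
def IrredWithin (ρ : Representation F G V) (N : Subgroup G) (U : Submodule F V) : Prop :=
  U ≠ ⊥ ∧ ∀ W : Submodule F V, W ≤ U → Stable ρ N W → W = ⊥ ∨ W = U

/-- The subspaces `U` and `U'` are isomorphic as `N`-modules: there is a linear
equivalence between them commuting with the action of every element of `N`. -/
def IsoWithin (ρ : Representation F G V) (N : Subgroup G) (U U' : Submodule F V) : Prop :=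
  ∃ e : U ≃ₗ[F] U', ∀ n ∈ N, ∀ (v : U) (h : ρ n (v : V) ∈ U),
    ((e ⟨ρ n (v : V), h⟩ : U') : V) = ρ n ((e v : U') : V)

/-- `U` is totally isotropic with respect to the bilinear form `B`. -/
def TotallyIsotropic (B : V →ₗ[F] V →ₗ[F] F) (U : Submodule F V) : Prop :=
  ∀ x ∈ U, ∀ y ∈ U, B x y = 0

/-- The fixed-point subspace of a single group element. -/
def fixedBy (ρ : Representation F G V) (g : G) : Submodule F V :=
  LinearMap.ker (ρ g - LinearMap.id)

/-- `V` is completely reducible as an `N`-module: it is a direct sum of irreducible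
`N`-submodules. -/
def CompletelyReducibleOn (ρ : Representation F G V) (N : Subgroup G) : Prop :=
  ∃ (ι : Type u) (U : ι → Submodule F V), (∀ i, Stable ρ N (U i)) ∧
    (∀ i, IrredWithin ρ N (U i)) ∧ iSupIndep U ∧ ⨆ i, U i = ⊤

/-- The representation of `G` on a `G`-stable subspace `U`. -/
def resRep (ρ : Representation F G V) (U : Submodule F V) (h : Stable ρ ⊤ U) :
    Representation F G ↥U where
  toFun g := (ρ g).restrict (fun v hv => h g (Subgroup.mem_top g) v hv)
  map_one' := by
    ext v
    simp [LinearMap.restrict_apply]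
  map_mul' g g' := by
    ext v
    simp [LinearMap.restrict_apply]

/-- A representation is self-dual if it is isomorphic to its dual representation. -/
def SelfDualRep {W : Type*} [AddCommGroup W] [Module F W] (σ : Representation F G W) : Prop :=
  ∃ e : W ≃ₗ[F] Module.Dual F W, ∀ (g : G) (w : W), e (σ g w) = σ.dual g (e w)

end RepDefs

/-- The representation of `G` on `Fin 3 → F` in which `g` acts as the sign `χ g`. -/
def signRep (F : Type*) [Field F] {G : Type*} [Group G] (χ : G →* ℤˣ) :
    Representation F G (Fin 3 → F) :=
  (algebraMap F (Module.End F (Fin 3 → F)) : F →* Module.End F (Fin 3 → F)).comp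
    ((Int.castRingHom F : ℤ →* F).comp ((Units.coeHom ℤ).comp χ))

theorem signRep_apply (F : Type*) [Field F] {G : Type*} [Group G] (χ : G →* ℤˣ) (g : G)
    (v : Fin 3 → F) : signRep F χ g v = (((χ g : ℤˣ) : ℤ) : F) • v := rfl

/-- If every element of `N` acts as a scalar, a basis splits the module into lines. -/
theorem completelyReducibleOn_of_scalar {F : Type*} [Field F] {G : Type*} [Group G]
    {V ι : Type u} [AddCommGroup V] [Module F V] (ρ : Representation F G V) (N : Subgroup G)
    (b : Module.Basis ι F V) (h : ∀ n ∈ N, ∃ c : F, ∀ v, ρ n v = c • v) :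
    CompletelyReducibleOn ρ N := by
  refine ⟨ι, fun i => F ∙ b i, fun i n hn v hv => ?_, fun i => ?_,
    b.linearIndependent.iSupIndep_span_singleton, ?_⟩
  · obtain ⟨c, hc⟩ := h n hn
    rw [hc]
    exact Submodule.smul_mem _ c hv
  · have atom : IsAtom (F ∙ b i) := nonzero_span_atom _ (b.ne_zero i)
    exact ⟨atom.1, fun W hW _ => atom.le_iff.1 hW⟩
  · rw [← Submodule.span_range_eq_iSup, b.span_eq]

theorem completelyReducibleOn_signRep {F : Type} [Field F] {G : Type*} [Group G]
    (χ : G →* ℤˣ) : CompletelyReducibleOn (signRep F χ) ⊤ :=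
  completelyReducibleOn_of_scalar _ _ (Pi.basisFun F (Fin 3))
    fun n _ => ⟨_, signRep_apply F χ n⟩

theorem finrank_fixedBy_signRep {F : Type*} [Field F] {G : Type*} [Group G]
    {χ : G →* ℤˣ} {g : G} (h : χ g = 1) :
    Module.finrank F (fixedBy (signRep F χ) g) = 3 := by
  have top : fixedBy (signRep F χ) g = ⊤ := by
    refine eq_top_iff.2 fun v _ => ?_
    simp [fixedBy, signRep_apply, h]
  rw [top, finrank_top, Module.finrank_fin_fun]

/-- The coset refinement of the fixed-point bound fails for the Klein four-group: there
are a group `G` of order `4` and exponent `2`, a subgroup `K` of order `2`, `t ∉ K`, odd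
primes `p₁, p₂` and `3`-dimensional completely reducible modules `V₁, V₂` over the
algebraic closures of `𝔽_{p₁}`, `𝔽_{p₂}` such that no element `g` of the coset `Kt`
satisfies both `dim C_{V₁}(g) ≤ (1/2)·dim V₁` and `dim C_{V₂}(g) ≤ (1/2)·dim V₂`. -/
theorem klein_counterexample :
    ∃ (G : Type) (_ : Group G) (_ : Fintype G),
      Fintype.card G = 4 ∧ (∀ x : G, x * x = 1) ∧
      ∃ (K : Subgroup G) (t : G), Nat.card ↥K = 2 ∧ t ∉ K ∧
      ∃ (p₁ p₂ : ℕ) (_ : Fact p₁.Prime) (_ : Fact p₂.Prime), Odd p₁ ∧ Odd p₂ ∧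
      ∃ (V₁ : Type) (_ : AddCommGroup V₁) (_ : Module (AlgebraicClosure (ZMod p₁)) V₁)
        (ρ₁ : Representation (AlgebraicClosure (ZMod p₁)) G V₁)
        (V₂ : Type) (_ : AddCommGroup V₂) (_ : Module (AlgebraicClosure (ZMod p₂)) V₂)
        (ρ₂ : Representation (AlgebraicClosure (ZMod p₂)) G V₂),
        Module.finrank (AlgebraicClosure (ZMod p₁)) V₁ = 3 ∧
        Module.finrank (AlgebraicClosure (ZMod p₂)) V₂ = 3 ∧
        CompletelyReducibleOn ρ₁ ⊤ ∧ CompletelyReducibleOn ρ₂ ⊤ ∧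
        ∀ k ∈ K,
          ¬((Module.finrank (AlgebraicClosure (ZMod p₁)) ↥(fixedBy ρ₁ (k * t)) : ℚ) ≤
              (Module.finrank (AlgebraicClosure (ZMod p₁)) V₁ : ℚ) / 2 ∧
            (Module.finrank (AlgebraicClosure (ZMod p₂)) ↥(fixedBy ρ₂ (k * t)) : ℚ) ≤
              (Module.finrank (AlgebraicClosure (ZMod p₂)) V₂ : ℚ) / 2) := by
  refine ⟨ℤˣ × ℤˣ, inferInstance, inferInstance, by decide, by decide,
    (MonoidHom.snd ℤˣ ℤˣ).ker, (1, -1), ?_, by decide,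
    3, 5, ⟨by norm_num⟩, ⟨by norm_num⟩, by decide, by decide,
    _, _, _, signRep _ (MonoidHom.fst ℤˣ ℤˣ),
    _, _, _, signRep _ (MonoidHom.fst ℤˣ ℤˣ * MonoidHom.snd ℤˣ ℤˣ),
    Module.finrank_fin_fun _, Module.finrank_fin_fun _,
    completelyReducibleOn_signRep _, completelyReducibleOn_signRep _, ?_⟩
  · rw [Nat.card_eq_fintype_card]
    decide
  · rintro ⟨a, b⟩ hk ⟨h₁, h₂⟩
    obtain rfl : b = 1 := hk
    rw [Module.finrank_fin_fun] at h₁ h₂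
    rcases Int.units_eq_one_or a with rfl | rfl
    · rw [finrank_fixedBy_signRep (by simp)] at h₁
      norm_num at h₁
    · rw [finrank_fixedBy_signRep (by simp)] at h₂
      norm_num at h₂
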